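/- Let A ∈ ℝ^{n×d}, b ∈ ℝ^n, and define u(x) = exp(Ax) ∈ ℝ^n, α(x) = ⟨u(x), 1_n⟩, c(x) = u(x) - α(x)·b, L_u(x) = 0.5·‖c(x)‖_2², and the n×n matrix B(x) = diag(u(x) ∘ u(x)) - (u(x) ∘ b)·u(x)^⊤ - u(x)·(u(x) ∘ b)^⊤ + ‖b‖_2² · u(x)u(x)^⊤ + diag(c(x) ∘ u(x)) - ⟨c(x), b⟩ · diag(u(x)). Then for all i, j ∈ [d], the second partial derivative of L_u with respect to x_i and x_j equals A_{*,i}^⊤ B(x) A_{*,j}, where A_{*,i} denotes the i-th column of A. -/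

import Mathlib

open Matrix

/-- The Euclidean (ℓ2) norm of a vector in `ℝ^n`. -/
noncomputable def norm2 {n : ℕ} (v : Fin n → ℝ) : ℝ :=
  Real.sqrt (∑ i, v i ^ 2)

/-- `u(x) = exp(Ax)` applied entrywise. -/
noncomputable def uexp {n d : ℕ} (A : Matrix (Fin n) (Fin d) ℝ) (x : Fin d → ℝ) : Fin n → ℝ :=
  fun j => Real.exp (A.mulVec x j)

/-- `α(x) = ⟨u(x), 1_n⟩`. -/
noncomputable def alph {n d : ℕ} (A : Matrix (Fin n) (Fin d) ℝ) (x : Fin d → ℝ) : ℝ :=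
  ∑ j, uexp A x j

/-- `c(x) = u(x) - α(x)·b`. -/
noncomputable def cfun {n d : ℕ} (A : Matrix (Fin n) (Fin d) ℝ) (b : Fin n → ℝ)
    (x : Fin d → ℝ) : Fin n → ℝ :=
  uexp A x - alph A x • b

/-- `L_u(x) = 0.5·‖c(x)‖_2²`. -/
noncomputable def Lu {n d : ℕ} (A : Matrix (Fin n) (Fin d) ℝ) (b : Fin n → ℝ)
    (x : Fin d → ℝ) : ℝ :=
  0.5 * ∑ j, cfun A b x j ^ 2

/-- `B(x) = diag(u∘u) - (u∘b)uᵀ - u(u∘b)ᵀ + ‖b‖₂²·uuᵀ + diag(c∘u) - ⟨c,b⟩·diag(u)`. -/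
noncomputable def Bmat {n d : ℕ} (A : Matrix (Fin n) (Fin d) ℝ) (b : Fin n → ℝ)
    (x : Fin d → ℝ) : Matrix (Fin n) (Fin n) ℝ :=
  Matrix.diagonal (fun k => uexp A x k * uexp A x k)
    - Matrix.vecMulVec (fun k => uexp A x k * b k) (uexp A x)
    - Matrix.vecMulVec (uexp A x) (fun k => uexp A x k * b k)
    + norm2 b ^ 2 • Matrix.vecMulVec (uexp A x) (uexp A x)
    + Matrix.diagonal (fun k => cfun A b x k * uexp A x k)
    - (∑ k, cfun A b x k * b k) • Matrix.diagonal (uexp A x)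

/-- The `k`-th row of `A` as a continuous linear functional `x ↦ (A x)_k`. -/
noncomputable def rowCLM {n d : ℕ} (A : Matrix (Fin n) (Fin d) ℝ) (k : Fin n) :
    (Fin d → ℝ) →L[ℝ] ℝ :=
  LinearMap.toContinuousLinearMap ((LinearMap.proj k).comp A.mulVecLin)

lemma rowCLM_apply {n d : ℕ} (A : Matrix (Fin n) (Fin d) ℝ) (k : Fin n) (x : Fin d → ℝ) :
    rowCLM A k x = A.mulVec x k := rfl

lemma rowCLM_single {n d : ℕ} (A : Matrix (Fin n) (Fin d) ℝ) (k : Fin n) (i : Fin d) :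
    rowCLM A k (Pi.single i 1) = A k i := by
  simp [rowCLM_apply]

lemma hasFDerivAt_uexp {n d : ℕ} (A : Matrix (Fin n) (Fin d) ℝ) (x : Fin d → ℝ) (k : Fin n) :
    HasFDerivAt (fun z => uexp A z k) (uexp A x k • rowCLM A k) x :=
  (rowCLM A k).hasFDerivAt.exp

lemma hasFDerivAt_cfun {n d : ℕ} (A : Matrix (Fin n) (Fin d) ℝ) (b : Fin n → ℝ)
    (x : Fin d → ℝ) (k : Fin n) :
    HasFDerivAt (fun z => cfun A b z k)
      (uexp A x k • rowCLM A k - b k • ∑ m, uexp A x m • rowCLM A m) x :=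
  (hasFDerivAt_uexp A x k).sub
    ((HasFDerivAt.fun_sum fun m _ => hasFDerivAt_uexp A x m).mul_const (b k))

lemma fderiv_Lu_single {n d : ℕ} (A : Matrix (Fin n) (Fin d) ℝ) (b : Fin n → ℝ)
    (x : Fin d → ℝ) (j : Fin d) :
    fderiv ℝ (Lu A b) x (Pi.single j 1)
      = ∑ k, cfun A b x k * (uexp A x k * A k j - (∑ m, uexp A x m * A m j) * b k) := by
  have h : HasFDerivAt (Lu A b) _ x :=
    (HasFDerivAt.fun_sum (u := Finset.univ)
      fun k _ => (hasFDerivAt_cfun A b x k).pow 2).const_mul (0.5 : ℝ)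
  rw [h.fderiv]
  simp only [_root_.smul_apply, _root_.sum_apply,
    _root_.sub_apply, rowCLM_single, smul_eq_mul, nsmul_eq_mul, Finset.mul_sum]
  refine Finset.sum_congr rfl fun k _ => ?_
  simp only [← Finset.mul_sum]
  norm_num
  ring

lemma norm2_sq {n : ℕ} (v : Fin n → ℝ) : norm2 v ^ 2 = ∑ k, v k ^ 2 :=
  Real.sq_sqrt (Finset.sum_nonneg fun _ _ => sq_nonneg _)

lemma dotProduct_Bmat_mulVec {n d : ℕ} (A : Matrix (Fin n) (Fin d) ℝ) (b : Fin n → ℝ)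
    (x : Fin d → ℝ) (v w : Fin n → ℝ) :
    v ⬝ᵥ (Bmat A b x).mulVec w
      = ∑ k, ((uexp A x k * v k - (∑ m, uexp A x m * v m) * b k)
            * (uexp A x k * w k - (∑ m, uexp A x m * w m) * b k)
          + cfun A b x k
            * (uexp A x k * v k * w k - (∑ m, uexp A x m * v m * w m) * b k)) := by
  have hvec (p q : Fin n → ℝ) :
      v ⬝ᵥ (Matrix.vecMulVec p q).mulVec w = (∑ k, p k * v k) * ∑ k, q k * w k := by
    rw [Matrix.vecMulVec_mulVec]
    simp only [dotProduct, Pi.smul_apply, MulOpposite.smul_eq_mul_unop, MulOpposite.unop_op,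
      Finset.sum_mul]
    exact Finset.sum_congr rfl fun _ _ => by ring
  have hdiag (p : Fin n → ℝ) :
      v ⬝ᵥ (Matrix.diagonal p).mulVec w = ∑ k, p k * v k * w k := by
    simp only [dotProduct, Matrix.mulVec_diagonal]
    exact Finset.sum_congr rfl fun _ _ => by ring
  simp only [Bmat, Matrix.add_mulVec, Matrix.sub_mulVec, Matrix.smul_mulVec, dotProduct_add,
    dotProduct_sub, dotProduct_smul, hvec, hdiag, norm2_sq, smul_eq_mul]
  generalize (∑ m, uexp A x m * v m) = s
  generalize (∑ m, uexp A x m * w m) = t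
  generalize (∑ m, uexp A x m * v m * w m) = r
  simp only [Finset.sum_mul, Finset.mul_sum, ← Finset.sum_add_distrib, ← Finset.sum_sub_distrib]
  exact Finset.sum_congr rfl fun _ _ => by ring

/-- The second partial derivative of `L_u` with respect to `x_i` and `x_j` equals
`A_{*,i}^⊤ B(x) A_{*,j}`. -/
theorem second_partial_Lu (n d : ℕ) (A : Matrix (Fin n) (Fin d) ℝ) (b : Fin n → ℝ)
    (x : Fin d → ℝ) (i j : Fin d) :
    fderiv ℝ (fun z => fderiv ℝ (Lu A b) z (Pi.single j 1)) x (Pi.single i 1)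
      = (fun p => A p i) ⬝ᵥ (Bmat A b x).mulVec (fun q => A q j) := by
  simp only [fderiv_Lu_single]
  have h := HasFDerivAt.fun_sum (u := Finset.univ) fun k _ =>
    (hasFDerivAt_cfun A b x k).mul
      (((hasFDerivAt_uexp A x k).mul_const (A k j)).sub
        ((HasFDerivAt.fun_sum (u := Finset.univ) fun m _ =>
          (hasFDerivAt_uexp A x m).mul_const (A m j)).mul_const (b k)))
  refine (congrArg (fun f => f (Pi.single i 1)) h.fderiv).trans ?_
  rw [dotProduct_Bmat_mulVec]
  simp only [_root_.sum_apply]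
  refine Finset.sum_congr rfl fun k _ => ?_
  simp only [_root_.add_apply, _root_.smul_apply,
    _root_.sum_apply, _root_.sub_apply, Pi.sub_apply, rowCLM_single,
    smul_eq_mul]
  have hr : ∑ m, A m j * (uexp A x m * A m i) = ∑ m, uexp A x m * A m i * A m j :=
    Finset.sum_congr rfl fun _ _ => by ring
  rw [hr]
  ring
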